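/- arXiv:1010.3320 — 12 statements merged into one kernel-verified Lean document; each statement's English description precedes it below -/
import Mathlib

section
/- Any two minimizers of the group lasso objective give the same vector of fitted values: if β¹ and β² both minimize L over ℝᵖ, then Xβ¹ = Xβ². -/
/-- The fitted values `Xβ` for a column-wise grouped design matrix
`X = (X₁ … X_K)` with `X k : ℝ^{n × p k}` and blockwise coefficients `β`. -/
noncomputable def fitted {n K : ℕ} {p : Fin K → ℕ}
    (X : ∀ k, Matrix (Fin n) (Fin (p k)) ℝ) (β : ∀ k, Fin (p k) → ℝ)
    (i : Fin n) : ℝ :=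
  ∑ k, ∑ j, X k i j * β k j

/-- The sum of the groupwise Euclidean norms `Σ_k ‖β_k‖₂`. -/
noncomputable def groupNormSum {K : ℕ} {p : Fin K → ℕ}
    (β : ∀ k, Fin (p k) → ℝ) : ℝ :=
  ∑ k, Real.sqrt (∑ j, β k j ^ 2)

/-- The group lasso objective `L(β) = (1/2)‖y − Xβ‖₂² + λ Σ_k ‖β_k‖₂`. -/
noncomputable def groupLasso {n K : ℕ} {p : Fin K → ℕ}
    (X : ∀ k, Matrix (Fin n) (Fin (p k)) ℝ) (y : Fin n → ℝ) (lam : ℝ)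
    (β : ∀ k, Fin (p k) → ℝ) : ℝ :=
  (1 / 2) * ∑ i, (y i - fitted X β i) ^ 2 + lam * groupNormSum β

/-- The fitted values at a midpoint are the average of the fitted values. -/
theorem fitted_midpoint {n K : ℕ} {p : Fin K → ℕ}
    (X : ∀ k, Matrix (Fin n) (Fin (p k)) ℝ) (β γ : ∀ k, Fin (p k) → ℝ) (i : Fin n) :
    fitted X (fun k j => (β k j + γ k j) / 2) i = (fitted X β i + fitted X γ i) / 2 := by
  simp only [fitted, ← Finset.sum_add_distrib, Finset.sum_div]
  refine Finset.sum_congr rfl fun k _ => Finset.sum_congr rfl fun j _ => ?_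
  ring

/-- The Euclidean norm of a midpoint is at most the average of the norms. -/
theorem sqrt_sum_sq_midpoint_le {ι : Type*} [Fintype ι] (u v : ι → ℝ) :
    Real.sqrt (∑ j, ((u j + v j) / 2) ^ 2) ≤
      (Real.sqrt (∑ j, u j ^ 2) + Real.sqrt (∑ j, v j ^ 2)) / 2 := by
  have h := norm_add_le (WithLp.toLp 2 u : EuclideanSpace ℝ ι) (WithLp.toLp 2 v)
  simp only [EuclideanSpace.norm_eq, PiLp.add_apply, Real.norm_eq_abs, sq_abs] at h
  have hscale : Real.sqrt (∑ j, ((u j + v j) / 2) ^ 2) =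
      Real.sqrt (∑ j, (u j + v j) ^ 2) / 2 := by
    simp only [div_pow, ← Finset.sum_div]
    rw [Real.sqrt_div' _ (by positivity), Real.sqrt_sq (by norm_num)]
  rw [hscale]
  linarith

/-- The sum of groupwise norms is midpoint convex. -/
theorem groupNormSum_midpoint_le {K : ℕ} {p : Fin K → ℕ} (β γ : ∀ k, Fin (p k) → ℝ) :
    groupNormSum (fun k j => (β k j + γ k j) / 2) ≤ (groupNormSum β + groupNormSum γ) / 2 := by
  simp only [groupNormSum, ← Finset.sum_add_distrib, Finset.sum_div]
  exact Finset.sum_le_sum fun k _ => sqrt_sum_sq_midpoint_le (β k) (γ k)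

/-- The parallelogram identity for squared residuals. -/
theorem sum_sq_sub_midpoint {ι : Type*} [Fintype ι] (y a b : ι → ℝ) :
    ∑ i, (y i - (a i + b i) / 2) ^ 2 =
      (∑ i, (y i - a i) ^ 2 + ∑ i, (y i - b i) ^ 2) / 2 - (∑ i, (a i - b i) ^ 2) / 4 := by
  simp only [← Finset.sum_add_distrib, Finset.sum_div, ← Finset.sum_sub_distrib]
  refine Finset.sum_congr rfl fun i _ => ?_
  ring

/-- Any two minimizers of the group lasso objective give the same fitted values. -/
theorem group_lasso_minimizers_same_fitted_values
    {n K : ℕ} {p : Fin K → ℕ}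
    (X : ∀ k, Matrix (Fin n) (Fin (p k)) ℝ) (y : Fin n → ℝ)
    (lam : ℝ) (hlam : 0 < lam)
    (β1 β2 : ∀ k, Fin (p k) → ℝ)
    (h1 : ∀ β, groupLasso X y lam β1 ≤ groupLasso X y lam β)
    (h2 : ∀ β, groupLasso X y lam β2 ≤ groupLasso X y lam β) :
    fitted X β1 = fitted X β2 := by
  have hm1 := h1 fun k j => (β1 k j + β2 k j) / 2
  have hm2 := h2 fun k j => (β1 k j + β2 k j) / 2
  have hpen := mul_le_mul_of_nonneg_left (groupNormSum_midpoint_le β1 β2) hlam.le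
  simp only [groupLasso, fitted_midpoint, sum_sq_sub_midpoint] at hm1 hm2
  have hle : ∑ i, (fitted X β1 i - fitted X β2 i) ^ 2 ≤ 0 := by linarith
  have hzero := (Finset.sum_eq_zero_iff_of_nonneg fun i _ => sq_nonneg _).mp
    (hle.antisymm (Finset.sum_nonneg fun i _ => sq_nonneg _))
  funext i
  exact sub_eq_zero.mp (pow_eq_zero_iff two_ne_zero |>.mp (hzero i (Finset.mem_univ i)))
end

section
/- Uniqueness of group directions for the group lasso: if β¹ and β² both minimize L over ℝᵖ and for some group k both blocks β¹_k and β²_k are nonzero, then there exists a scalar c > 0 with β¹_k = c · β²_k. -/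
theorem fitted_add {n K : ℕ} {p : Fin K → ℕ}
    (X : ∀ k, Matrix (Fin n) (Fin (p k)) ℝ) (β γ : ∀ k, Fin (p k) → ℝ) (i : Fin n) :
    fitted X (β + γ) i = fitted X β i + fitted X γ i := by
  simp [fitted, mul_add, Finset.sum_add_distrib]

theorem fitted_smul {n K : ℕ} {p : Fin K → ℕ}
    (X : ∀ k, Matrix (Fin n) (Fin (p k)) ℝ) (a : ℝ) (β : ∀ k, Fin (p k) → ℝ) (i : Fin n) :
    fitted X (a • β) i = a * fitted X β i := by
  simp [fitted, Finset.mul_sum, mul_left_comm]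

theorem groupNormSum_eq_sum_norm {K : ℕ} {p : Fin K → ℕ} (β : ∀ k, Fin (p k) → ℝ) :
    groupNormSum β = ∑ k, ‖WithLp.toLp 2 (β k)‖ := by
  simp [groupNormSum, EuclideanSpace.norm_eq]

theorem groupNormSum_smul {K : ℕ} {p : Fin K → ℕ} (a : ℝ) (β : ∀ k, Fin (p k) → ℝ) :
    groupNormSum (a • β) = |a| * groupNormSum β := by
  simp [groupNormSum_eq_sum_norm, WithLp.toLp_smul, norm_smul, Finset.mul_sum]

/-- The squared-error part of the objective is midpoint convex. -/
theorem sum_sq_residual_midpoint_le {n K : ℕ} {p : Fin K → ℕ}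
    (X : ∀ k, Matrix (Fin n) (Fin (p k)) ℝ) (y : Fin n → ℝ) (β γ : ∀ k, Fin (p k) → ℝ) :
    2 * ∑ i, (y i - fitted X ((1 / 2 : ℝ) • (β + γ)) i) ^ 2 ≤
      ∑ i, (y i - fitted X β i) ^ 2 + ∑ i, (y i - fitted X γ i) ^ 2 := by
  rw [Finset.mul_sum, ← Finset.sum_add_distrib]
  refine Finset.sum_le_sum fun i _ => ?_
  rw [fitted_smul, fitted_add]
  nlinarith [sq_nonneg (fitted X β i - fitted X γ i)]

/-- Equality in the triangle inequality for the sum of group norms forces equality, hence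
positive proportionality, in every group. -/
theorem sameRay_of_groupNormSum_add_le {K : ℕ} {p : Fin K → ℕ} {β γ : ∀ k, Fin (p k) → ℝ}
    (h : groupNormSum β + groupNormSum γ ≤ groupNormSum (β + γ)) (k : Fin K) :
    SameRay ℝ (WithLp.toLp 2 (β k)) (WithLp.toLp 2 (γ k)) := by
  simp only [groupNormSum_eq_sum_norm, Pi.add_apply, WithLp.toLp_add,
    ← Finset.sum_add_distrib] at h
  have hle : ∀ l ∈ Finset.univ, ‖WithLp.toLp 2 (β l) + WithLp.toLp 2 (γ l)‖ ≤
      ‖WithLp.toLp 2 (β l)‖ + ‖WithLp.toLp 2 (γ l)‖ := fun l _ => norm_add_le _ _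
  exact sameRay_iff_norm_add.2 <|
    (Finset.sum_eq_sum_iff_of_le hle).1 ((Finset.sum_le_sum hle).antisymm h) k (Finset.mem_univ k)

/-- Uniqueness of group directions: nonzero blocks of any two group lasso
minimizers are positively proportional. -/
theorem group_lasso_minimizers_proportional_blocks
    {n K : ℕ} {p : Fin K → ℕ}
    (X : ∀ k, Matrix (Fin n) (Fin (p k)) ℝ) (y : Fin n → ℝ)
    (lam : ℝ) (hlam : 0 < lam)
    (β1 β2 : ∀ k, Fin (p k) → ℝ)
    (h1 : ∀ β, groupLasso X y lam β1 ≤ groupLasso X y lam β)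
    (h2 : ∀ β, groupLasso X y lam β2 ≤ groupLasso X y lam β)
    (k : Fin K) (hk1 : β1 k ≠ 0) (hk2 : β2 k ≠ 0) :
    ∃ c : ℝ, 0 < c ∧ β1 k = c • β2 k := by
  have hfit := sum_sq_residual_midpoint_le X y β1 β2
  have hmid1 := h1 ((1 / 2 : ℝ) • (β1 + β2))
  have hmid2 := h2 ((1 / 2 : ℝ) • (β1 + β2))
  unfold groupLasso at hmid1 hmid2
  rw [groupNormSum_smul, abs_of_pos one_half_pos] at hmid1 hmid2
  have hnorm : groupNormSum β1 + groupNormSum β2 ≤ groupNormSum (β1 + β2) := by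
    refine le_of_mul_le_mul_left ?_ hlam
    linarith
  obtain ⟨c, hc, hβ⟩ := (sameRay_of_groupNormSum_add_le hnorm k).symm.exists_pos_left
    (by simpa using hk2) (by simpa using hk1)
  refine ⟨c, hc, ?_⟩
  rw [← WithLp.toLp_smul] at hβ
  exact (WithLp.toLp_injective 2 hβ).symm
end

section
/- The single-group objective Q attains its minimum over ℝ^q at a unique point: there exists a unique α̂ ∈ ℝ^q such that Q(α̂) ≤ Q(α) for all α ∈ ℝ^q. -/
/-- The single-group group lasso objective
`Q(α) = (1/2)‖b − Aα‖₂² + λ‖α‖₂`. -/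
noncomputable def Qobj {n q : ℕ} (b : Fin n → ℝ) (A : Matrix (Fin n) (Fin q) ℝ)
    (lam : ℝ) (α : Fin q → ℝ) : ℝ :=
  (1 / 2) * ∑ i, (b i - A.mulVec α i) ^ 2 + lam * Real.sqrt (∑ j, α j ^ 2)

theorem norm_le_sqrt_sum_sq {q : ℕ} (α : Fin q → ℝ) : ‖α‖ ≤ Real.sqrt (∑ j, α j ^ 2) := by
  refine (pi_norm_le_iff_of_nonneg (Real.sqrt_nonneg _)).2 fun i => ?_
  rw [Real.norm_eq_abs]
  exact Real.abs_le_sqrt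
    (Finset.single_le_sum (f := fun j => α j ^ 2) (fun j _ => sq_nonneg _) (Finset.mem_univ i))

theorem sqrt_sum_sq_midpoint_le_s4 {q : ℕ} (x y : Fin q → ℝ) :
    Real.sqrt (∑ j, ((x j + y j) / 2) ^ 2) ≤
      (Real.sqrt (∑ j, x j ^ 2) + Real.sqrt (∑ j, y j ^ 2)) / 2 := by
  have h := norm_add_le (WithLp.toLp 2 x : EuclideanSpace ℝ (Fin q)) (WithLp.toLp 2 y)
  simp only [EuclideanSpace.norm_eq, PiLp.add_apply, Real.norm_eq_abs, sq_abs] at h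
  have e : ∑ j, ((x j + y j) / 2) ^ 2 = (∑ j, (x j + y j) ^ 2) / 2 ^ 2 := by
    rw [Finset.sum_div]
    exact Finset.sum_congr rfl fun j _ => by ring
  rw [e, Real.sqrt_div' _ (by positivity), Real.sqrt_sq (by norm_num)]
  linarith

theorem sum_sq_midpoint {n : ℕ} (x y : Fin n → ℝ) :
    ∑ i, ((x i + y i) / 2) ^ 2 =
      (∑ i, x i ^ 2 + ∑ i, y i ^ 2) / 2 - (∑ i, (x i - y i) ^ 2) / 4 := by
  rw [← Finset.sum_add_distrib, Finset.sum_div, Finset.sum_div, ← Finset.sum_sub_distrib]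
  exact Finset.sum_congr rfl fun i _ => by ring

theorem eq_of_sum_sq_sub_nonpos {n : ℕ} {x y : Fin n → ℝ}
    (h : ∑ i, (x i - y i) ^ 2 ≤ 0) : x = y := by
  have h0 := le_antisymm h (Finset.sum_nonneg fun i _ => sq_nonneg (x i - y i))
  rw [Finset.sum_eq_zero_iff_of_nonneg fun i _ => sq_nonneg _] at h0
  funext i
  exact sub_eq_zero.1 (pow_eq_zero_iff two_ne_zero |>.1 (h0 i (Finset.mem_univ i)))

theorem continuous_Qobj {n q : ℕ} (b : Fin n → ℝ) (A : Matrix (Fin n) (Fin q) ℝ) (lam : ℝ) :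
    Continuous (Qobj b A lam) := by
  unfold Qobj Matrix.mulVec dotProduct
  fun_prop

theorem exists_forall_Qobj_le {n q : ℕ} (b : Fin n → ℝ) (A : Matrix (Fin n) (Fin q) ℝ)
    {lam : ℝ} (hlam : 0 < lam) :
    ∃ x, ∀ α, Qobj b A lam x ≤ Qobj b A lam α := by
  refine (continuous_Qobj b A lam).exists_forall_le ?_
  refine Filter.tendsto_atTop_mono (fun α => ?_)
    ((tendsto_norm_cocompact_atTop (E := Fin q → ℝ)).const_mul_atTop hlam)
  have h1 := mul_le_mul_of_nonneg_left (norm_le_sqrt_sum_sq α) hlam.le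
  have h2 : 0 ≤ ∑ i, (b i - A.mulVec α i) ^ 2 := Finset.sum_nonneg fun i _ => sq_nonneg _
  unfold Qobj
  linarith

theorem Qobj_minimizer_unique {n q : ℕ} {b : Fin n → ℝ} {A : Matrix (Fin n) (Fin q) ℝ}
    {lam : ℝ} (hlam : 0 < lam) {x y : Fin q → ℝ}
    (hx : ∀ α, Qobj b A lam x ≤ Qobj b A lam α) (hy : ∀ α, Qobj b A lam y ≤ Qobj b A lam α) :
    x = y := by
  have hxy := le_antisymm (hx y) (hy x)
  have hm := hx fun j => (x j + y j) / 2
  have hS := sqrt_sum_sq_midpoint_le_s4 x y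
  have hR := sum_sq_midpoint (fun i => b i - A.mulVec x i) (fun i => b i - A.mulVec y i)
  have hmul (i : Fin n) : b i - A.mulVec (fun j => (x j + y j) / 2) i =
      ((b i - A.mulVec x i) + (b i - A.mulVec y i)) / 2 := by
    have : (fun j => (x j + y j) / 2) = (1 / 2 : ℝ) • (x + y) := by
      funext j
      simp only [Pi.smul_apply, Pi.add_apply, smul_eq_mul]
      ring
    rw [this, Matrix.mulVec_smul, Matrix.mulVec_add]
    simp only [Pi.smul_apply, Pi.add_apply, smul_eq_mul]
    ring
  unfold Qobj at hxy hm
  simp only [hmul] at hm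
  rw [hR] at hm
  have hS' := mul_le_mul_of_nonneg_left hS hlam.le
  have hres := eq_of_sum_sq_sub_nonpos
    (x := fun i => b i - A.mulVec x i) (y := fun i => b i - A.mulVec y i) (by linarith)
  have hres' (i : Fin n) : b i - A.mulVec x i = b i - A.mulVec y i := congrFun hres i
  simp only [hres', sub_self] at hxy hm
  have hnorm : Real.sqrt (∑ j, x j ^ 2) = Real.sqrt (∑ j, y j ^ 2) :=
    mul_left_cancel₀ hlam.ne' (by linarith)
  have hle : Real.sqrt (∑ j, x j ^ 2) ≤ Real.sqrt (∑ j, ((x j + y j) / 2) ^ 2) := by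
    refine le_of_mul_le_mul_left ?_ hlam
    simp only [ne_eq, OfNat.ofNat_ne_zero, not_false_eq_true, zero_pow,
      Finset.sum_const_zero] at hm
    linarith
  have nonneg (z : Fin q → ℝ) : 0 ≤ ∑ j, z j ^ 2 := Finset.sum_nonneg fun j _ => sq_nonneg _
  rw [Real.sqrt_le_sqrt_iff (nonneg _), sum_sq_midpoint] at hle
  rw [Real.sqrt_inj (nonneg x) (nonneg y)] at hnorm
  exact eq_of_sum_sq_sub_nonpos (by linarith)

/-- The single-group objective `Q` attains its minimum at a unique point. -/
theorem Qobj_exists_unique_minimizer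
    {n q : ℕ} (b : Fin n → ℝ) (A : Matrix (Fin n) (Fin q) ℝ)
    (lam : ℝ) (hlam : 0 < lam) :
    ∃! αhat : Fin q → ℝ, ∀ α, Qobj b A lam αhat ≤ Qobj b A lam α := by
  obtain ⟨x, hx⟩ := exists_forall_Qobj_le b A hlam
  exact ⟨x, hx, fun y hy => Qobj_minimizer_unique hlam hy hx⟩
end

section
/- Zero is a minimizer of Q if and only if ‖Aᵀb‖₂ ≤ λ; that is, α = 0 satisfies Q(0) ≤ Q(α) for all α ∈ ℝ^q if and only if ‖Aᵀb‖₂ ≤ λ. -/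
/-- The increment of `Q` over its value at zero, with the square expanded. -/
theorem Qobj_eq_Qobj_zero_add {n q : ℕ} (b : Fin n → ℝ) (A : Matrix (Fin n) (Fin q) ℝ)
    (lam : ℝ) (α : Fin q → ℝ) :
    Qobj b A lam α = Qobj b A lam 0 - ∑ j, A.transpose.mulVec b j * α j
      + (1 / 2) * ∑ i, (A.mulVec α i) ^ 2 + lam * Real.sqrt (∑ j, α j ^ 2) := by
  have adjoint : ∑ j, A.transpose.mulVec b j * α j = ∑ i, b i * A.mulVec α i := by
    have h := Matrix.dotProduct_mulVec b A α
    rw [← Matrix.mulVec_transpose] at h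
    exact h.symm
  have expand : ∑ i, (b i - A.mulVec α i) ^ 2
      = ∑ i, b i ^ 2 - 2 * ∑ i, b i * A.mulVec α i + ∑ i, (A.mulVec α i) ^ 2 := by
    rw [Finset.mul_sum, ← Finset.sum_sub_distrib, ← Finset.sum_add_distrib]
    exact Finset.sum_congr rfl fun i _ => by ring
  have zero : Qobj b A lam 0 = (1 / 2) * ∑ i, b i ^ 2 := by
    simp [Qobj]
  rw [adjoint, zero, Qobj, expand]
  ring

/-- `α = 0` minimizes `Q` if and only if `‖Aᵀb‖₂ ≤ λ`. -/
theorem Qobj_zero_minimizer_iff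
    {n q : ℕ} (b : Fin n → ℝ) (A : Matrix (Fin n) (Fin q) ℝ)
    (lam : ℝ) (hlam : 0 < lam) :
    (∀ α, Qobj b A lam 0 ≤ Qobj b A lam α) ↔
      Real.sqrt (∑ j, (A.transpose.mulVec b j) ^ 2) ≤ lam := by
  constructor
  · intro h
    set v := A.transpose.mulVec b with hv
    set N := Real.sqrt (∑ j, v j ^ 2) with hN
    have hN2 : ∑ j, v j ^ 2 = N ^ 2 :=
      (Real.sq_sqrt (Finset.sum_nonneg fun j _ => sq_nonneg (v j))).symm
    set C := ∑ i, (A.mulVec v i) ^ 2 with hC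
    have hC0 : 0 ≤ C := Finset.sum_nonneg fun i _ => sq_nonneg _
    by_contra! hlt
    have key : ∀ t : ℝ, 0 < t → N * (N - lam) ≤ t * C / 2 := by
      intro t ht
      have h1 := h (t • v)
      have hinner : ∑ j, v j * (t • v) j = t * N ^ 2 := by
        rw [← hN2, Finset.mul_sum]
        exact Finset.sum_congr rfl fun j _ => by simp only [Pi.smul_apply, smul_eq_mul]; ring
      have hnorm : Real.sqrt (∑ j, (t • v) j ^ 2) = t * N := by
        simp only [Pi.smul_apply, smul_eq_mul, mul_pow]
        rw [← Finset.mul_sum, Real.sqrt_mul (sq_nonneg t), Real.sqrt_sq ht.le]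
      have hquad : ∑ i, (A.mulVec (t • v) i) ^ 2 = t ^ 2 * C := by
        simp only [Matrix.mulVec_smul, Pi.smul_apply, smul_eq_mul, mul_pow]
        rw [← Finset.mul_sum]
      rw [Qobj_eq_Qobj_zero_add b A lam (t • v), ← hv, hinner, hnorm, hquad] at h1
      refine le_of_mul_le_mul_left ?_ ht
      linarith
    have hd : 0 < N * (N - lam) := mul_pos (hlam.trans hlt) (sub_pos.2 hlt)
    have h2 := key (N * (N - lam) / (C + 1)) (by positivity)
    have h3 : N * (N - lam) / (C + 1) * (C + 1) = N * (N - lam) :=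
      div_mul_cancel₀ _ (by positivity)
    have h4 : 0 < N * (N - lam) / (C + 1) := by positivity
    nlinarith
  · intro h α
    have cauchy := Real.sum_mul_le_sqrt_mul_sqrt Finset.univ (A.transpose.mulVec b) α
    have bound := mul_le_mul_of_nonneg_right h (Real.sqrt_nonneg (∑ j, α j ^ 2))
    have quad : 0 ≤ ∑ i, (A.mulVec α i) ^ 2 := Finset.sum_nonneg fun i _ => sq_nonneg _
    rw [Qobj_eq_Qobj_zero_add b A lam α]
    linarith
end

section
/- Existence and uniqueness of the line-search root: let λ > 0, let d ∈ ℝ^q satisfy d_j ≥ 0 for all j, and let v ∈ ℝ^q satisfy v_j = 0 whenever d_j = 0. If ‖v‖₂ > λ, then there exists a unique r > 0 such that Σ_{j=1}^{q} v_j² / (d_j r + λ)² = 1. -/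
open Filter Topology in
/-- A secular function whose numerator vanishes wherever its slope does decays to `0`. -/
theorem tendsto_sum_sq_div_sq_atTop_zero {ι : Type*} [Fintype ι] (lam : ℝ) (d v : ι → ℝ)
    (hd : ∀ j, 0 ≤ d j) (hv : ∀ j, d j = 0 → v j = 0) :
    Tendsto (fun r : ℝ => ∑ j, v j ^ 2 / (d j * r + lam) ^ 2) atTop (𝓝 0) := by
  rw [← Finset.sum_const_zero (ι := ι) (s := Finset.univ)]
  refine tendsto_finsetSum _ fun j _ => ?_
  rcases (hd j).eq_or_lt with h | h
  · simp [hv j h.symm]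
  · refine Tendsto.const_div_atTop ?_ _
    exact (tendsto_pow_atTop two_ne_zero).comp
      (tendsto_atTop_add_const_right _ _ (tendsto_id.const_mul_atTop h))

/-- A secular function with positive shift is strictly decreasing on `[0, ∞)` unless its
numerator is identically zero. -/
theorem strictAntiOn_sum_sq_div_sq {ι : Type*} [Fintype ι] {lam : ℝ} (hlam : 0 < lam)
    (d v : ι → ℝ) (hd : ∀ j, 0 ≤ d j) (hv : ∀ j, d j = 0 → v j = 0) (hne : ∃ j, v j ≠ 0) :
    StrictAntiOn (fun r : ℝ => ∑ j, v j ^ 2 / (d j * r + lam) ^ 2) (Set.Ici 0) := by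
  intro x hx y _ hxy
  have hpos (j : ι) : 0 < d j * x + lam :=
    add_pos_of_nonneg_of_pos (mul_nonneg (hd j) hx) hlam
  refine Finset.sum_lt_sum (fun j _ => ?_) ?_
  · have := hpos j
    have := hd j
    gcongr
  · obtain ⟨j, hj⟩ := hne
    have := hpos j
    have : 0 < d j := (hd j).lt_of_ne fun h => hj (hv j h.symm)
    refine ⟨j, Finset.mem_univ j, ?_⟩
    have : 0 < v j ^ 2 := by positivity
    gcongr

/-- Existence and uniqueness of the line-search root: if `d ≥ 0` entrywise,
`v_j = 0` whenever `d_j = 0`, and `‖v‖₂ > λ`, then there is a unique `r > 0`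
with `Σ_j v_j² / (d_j r + λ)² = 1`. -/
theorem line_search_root_exists_unique
    {q : ℕ} (hq : 0 < q) (lam : ℝ) (hlam : 0 < lam)
    (d v : Fin q → ℝ)
    (hd : ∀ j, 0 ≤ d j)
    (hv : ∀ j, d j = 0 → v j = 0)
    (hnorm : lam < Real.sqrt (∑ j, v j ^ 2)) :
    ∃! r : ℝ, 0 < r ∧ ∑ j, v j ^ 2 / (d j * r + lam) ^ 2 = 1 := by
  have hsum : lam ^ 2 < ∑ j, v j ^ 2 := (Real.lt_sqrt hlam.le).1 hnorm
  have hne : ∃ j, v j ≠ 0 := by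
    by_contra! h
    simp only [h, ne_eq, OfNat.ofNat_ne_zero, not_false_eq_true, zero_pow,
      Finset.sum_const_zero] at hsum
    exact absurd hsum (sq_nonneg lam).not_gt
  have hanti := strictAntiOn_sum_sq_div_sq hlam d v hd hv hne
  have hlim := tendsto_sum_sq_div_sq_atTop_zero lam d v hd hv
  set f : ℝ → ℝ := fun r => ∑ j, v j ^ 2 / (d j * r + lam) ^ 2 with hf
  have hzero : 1 < f 0 := by
    simp only [hf, mul_zero, zero_add, ← Finset.sum_div]
    exact (one_lt_div (by positivity)).2 hsum
  obtain ⟨R, hR, hR0⟩ :=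
    ((hlim.eventually_lt_const one_pos).and (Filter.eventually_ge_atTop 0)).exists
  have hcont : ContinuousOn f (Set.Icc 0 R) := by
    refine continuousOn_finsetSum _ fun j _ => ContinuousOn.div (by fun_prop) (by fun_prop) ?_
    intro x hx
    have := mul_nonneg (hd j) hx.1
    positivity
  obtain ⟨r, hr, hr1⟩ := intermediate_value_Icc' hR0 hcont ⟨hR.le, hzero.le⟩
  have hr0 : 0 < r := hr.1.lt_of_ne fun h => by
    rw [← h] at hr1
    exact hzero.ne' hr1
  exact ⟨r, ⟨hr0, hr1⟩, fun s hs => hanti.injOn hs.1.le hr0.le (hs.2.trans hr1.symm)⟩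
end

section
/- Subgradient characterization of the nonzero minimizer of Q: if α ∈ ℝ^q is nonzero and satisfies AᵀAα + λ · α/‖α‖₂ = Aᵀb, then α is the unique minimizer of Q over ℝ^q. -/
/-- Subgradient characterization: if `α ≠ 0` satisfies
`AᵀAα + λ α/‖α‖₂ = Aᵀb`, then `α` is the unique minimizer of `Q`. -/
theorem Qobj_subgradient_eq_implies_unique_minimizer
    {n q : ℕ} (b : Fin n → ℝ) (A : Matrix (Fin n) (Fin q) ℝ)
    (lam : ℝ) (hlam : 0 < lam)
    (α : Fin q → ℝ) (hα : α ≠ 0)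
    (hsub : ∀ j, (A.transpose * A).mulVec α j
        + lam * α j / Real.sqrt (∑ j', α j' ^ 2) = A.transpose.mulVec b j) :
    ∀ α', α' ≠ α → Qobj b A lam α < Qobj b A lam α' := by
  intro α' hne
  have hSpos : 0 < ∑ j, α j ^ 2 := by
    obtain ⟨k, hk⟩ := Function.ne_iff.mp hα
    exact Finset.sum_pos' (fun j _ => sq_nonneg _) ⟨k, Finset.mem_univ k, by
      have : α k ≠ 0 := hk
      positivity⟩
  have hDpos : 0 < ∑ j, (α' j - α j) ^ 2 := by
    obtain ⟨k, hk⟩ := Function.ne_iff.mp hne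
    exact Finset.sum_pos' (fun j _ => sq_nonneg _) ⟨k, Finset.mem_univ k, by
      have : α' k - α k ≠ 0 := sub_ne_zero.mpr hk
      positivity⟩
  have hdot : lam * (∑ j, α j * (α' j - α j)) / Real.sqrt (∑ j, α j ^ 2)
      = ∑ i, (b i - A.mulVec α i) * (A.mulVec α' i - A.mulVec α i) := by
    have hr : A.transpose.mulVec (b - A.mulVec α)
        = fun j => lam * α j / Real.sqrt (∑ j', α j' ^ 2) := by
      ext j
      rw [Matrix.mulVec_sub, Matrix.mulVec_mulVec, Pi.sub_apply, ← hsub j]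
      ring
    have hadj : (b - A.mulVec α) ⬝ᵥ A.mulVec (α' - α)
        = A.transpose.mulVec (b - A.mulVec α) ⬝ᵥ (α' - α) := by
      rw [Matrix.dotProduct_mulVec, Matrix.mulVec_transpose]
    rw [hr, Matrix.mulVec_sub] at hadj
    simp only [dotProduct, Pi.sub_apply] at hadj
    rw [hadj, Finset.mul_sum, Finset.sum_div]
    exact Finset.sum_congr rfl fun j _ => by ring
  have hloss : ∑ i, (b i - A.mulVec α' i) ^ 2 = ∑ i, (b i - A.mulVec α i) ^ 2
      - 2 * ∑ i, (b i - A.mulVec α i) * (A.mulVec α' i - A.mulVec α i)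
      + ∑ i, (A.mulVec α' i - A.mulVec α i) ^ 2 := by
    rw [Finset.mul_sum, ← Finset.sum_sub_distrib, ← Finset.sum_add_distrib]
    exact Finset.sum_congr rfl fun i _ => by ring
  have hnorm : ∑ j, α' j ^ 2 = ∑ j, α j ^ 2 + 2 * ∑ j, α j * (α' j - α j)
      + ∑ j, (α' j - α j) ^ 2 := by
    rw [Finset.mul_sum, ← Finset.sum_add_distrib, ← Finset.sum_add_distrib]
    exact Finset.sum_congr rfl fun j _ => by ring
  have hcs : (∑ j, α j * (α' j - α j)) ^ 2 ≤ (∑ j, α j ^ 2) * ∑ j, (α' j - α j) ^ 2 :=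
    Finset.sum_mul_sq_le_sq_mul_sq _ _ _
  have hfit : 0 ≤ ∑ i, (A.mulVec α' i - A.mulVec α i) ^ 2 :=
    Finset.sum_nonneg fun i _ => sq_nonneg _
  have hfit_zero : ∑ i, (A.mulVec α' i - A.mulVec α i) ^ 2 = 0 →
      ∑ i, (b i - A.mulVec α i) * (A.mulVec α' i - A.mulVec α i) = 0 := by
    intro h
    rw [Finset.sum_eq_zero_iff_of_nonneg fun i _ => sq_nonneg _] at h
    exact Finset.sum_eq_zero fun i hi => by rw [pow_eq_zero_iff two_ne_zero |>.mp (h i hi), mul_zero]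
  have hS'nonneg : 0 ≤ ∑ j, α' j ^ 2 := Finset.sum_nonneg fun j _ => sq_nonneg _
  unfold Qobj
  rw [hloss]
  have hs := Real.sqrt_pos.mpr hSpos
  have hs2 := Real.sq_sqrt hSpos.le
  have hs' := Real.sqrt_nonneg (∑ j, α' j ^ 2)
  have hs'2 := Real.sq_sqrt hS'nonneg
  rw [← hdot] at hfit_zero ⊢
  generalize ∑ j, α j * (α' j - α j) = c at *
  generalize ∑ j, (α' j - α j) ^ 2 = d at *
  generalize ∑ i, (A.mulVec α' i - A.mulVec α i) ^ 2 = u at *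
  generalize Real.sqrt (∑ j, α j ^ 2) = s at *
  generalize Real.sqrt (∑ j, α' j ^ 2) = t at *
  rw [← hs2] at hnorm hcs
  rw [← hs'2] at hnorm
  have hbound : s + c / s ≤ t := by
    refine abs_le_of_sq_le_sq' ?_ hs' |>.2
    have hcd : (c / s) ^ 2 ≤ d := by
      rw [div_pow, div_le_iff₀ (by positivity)]
      linarith
    have hcross : s * (c / s) = c := mul_div_cancel₀ c hs.ne'
    linear_combination hcd - hnorm + 2 * hcross
  rcases hfit.eq_or_lt with hu | hu
  · have hc : c = 0 := by
      have := hfit_zero hu.symm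
      simpa [hlam.ne', hs.ne'] using this
    subst hc
    have hst : s < t := by nlinarith
    have := mul_lt_mul_of_pos_left hst hlam
    simp only [mul_zero, zero_div]
    linarith
  · have := mul_le_mul_of_nonneg_left hbound hlam.le
    rw [mul_add, ← mul_div_assoc] at this
    linarith
end

section
/- Closed-form minimizer of Q from the line search: let r > 0 and suppose α ∈ ℝ^q satisfies (AᵀA + (λ/r)·I_q) α = Aᵀb and ‖α‖₂ = r. Then α is the unique minimizer of Q over ℝ^q. -/
open Matrix in
/-- Stationarity in weak form: the residual `b − Aα` tested against `Av`. -/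
theorem sum_mulVec_mul_residual_of_regularized_normal_eq {n q : ℕ} {b : Fin n → ℝ}
    {A : Matrix (Fin n) (Fin q) ℝ} {c : ℝ} {α : Fin q → ℝ}
    (h : (A.transpose * A + c • (1 : Matrix (Fin q) (Fin q) ℝ)).mulVec α
        = A.transpose.mulVec b) (v : Fin q → ℝ) :
    ∑ i, A.mulVec v i * (b i - A.mulVec α i) = c * ∑ j, v j * α j := by
  have h' := congrArg (fun w => v ⬝ᵥ w) h
  simp only [add_mulVec, smul_mulVec, one_mulVec, dotProduct_add, dotProduct_smul,
    ← mulVec_mulVec, dotProduct_mulVec v Aᵀ, vecMul_transpose, smul_eq_mul] at h'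
  simp only [mul_sub, Finset.sum_sub_distrib]
  simp only [dotProduct] at h'
  linarith

/-- Closed-form minimizer from the line search: if `r > 0`,
`(AᵀA + (λ/r) I) α = Aᵀb` and `‖α‖₂ = r`, then `α` is the unique
minimizer of `Q`. -/
theorem Qobj_closed_form_unique_minimizer
    {n q : ℕ} (b : Fin n → ℝ) (A : Matrix (Fin n) (Fin q) ℝ)
    (lam : ℝ) (hlam : 0 < lam)
    (r : ℝ) (hr : 0 < r) (α : Fin q → ℝ)
    (heq : (A.transpose * A + (lam / r) • (1 : Matrix (Fin q) (Fin q) ℝ)).mulVec α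
        = A.transpose.mulVec b)
    (hnorm : Real.sqrt (∑ j, α j ^ 2) = r) :
    ∀ α', α' ≠ α → Qobj b A lam α < Qobj b A lam α' := by
  intro α' hne
  have key := sum_mulVec_mul_residual_of_regularized_normal_eq heq
  have hr2 : ∑ j, α j ^ 2 = r ^ 2 := by
    rw [← hnorm, Real.sq_sqrt (Finset.sum_nonneg fun j _ => sq_nonneg _)]
  obtain ⟨s, hs⟩ : ∃ s, s = Real.sqrt (∑ j, α' j ^ 2) := ⟨_, rfl⟩
  have hs0 : 0 ≤ s := hs ▸ Real.sqrt_nonneg _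
  have hs2 : ∑ j, α' j ^ 2 = s ^ 2 := by
    rw [hs, Real.sq_sqrt (Finset.sum_nonneg fun j _ => sq_nonneg _)]
  have kα : ∑ i, A.mulVec α i * (b i - A.mulVec α i) = lam / r * r ^ 2 := by
    rw [key α, ← hr2]
    simp only [sq]
  have kα' := key α'
  have hloss : ∑ i, (b i - A.mulVec α' i) ^ 2 = ∑ i, (b i - A.mulVec α i) ^ 2
      - 2 * ∑ i, A.mulVec α' i * (b i - A.mulVec α i)
      + 2 * ∑ i, A.mulVec α i * (b i - A.mulVec α i)
      + ∑ i, (A.mulVec α' i - A.mulVec α i) ^ 2 := by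
    simp only [Finset.mul_sum, ← Finset.sum_sub_distrib, ← Finset.sum_add_distrib]
    exact Finset.sum_congr rfl fun i _ => by ring
  have hcs : ∑ j, (r * α' j - s * α j) ^ 2 = 2 * r * s * (r * s - ∑ j, α' j * α j) := by
    have : ∑ j, (r * α' j - s * α j) ^ 2 = r ^ 2 * ∑ j, α' j ^ 2
        - 2 * r * s * ∑ j, α' j * α j + s ^ 2 * ∑ j, α j ^ 2 := by
      simp only [Finset.mul_sum, ← Finset.sum_sub_distrib, ← Finset.sum_add_distrib]
      exact Finset.sum_congr rfl fun j _ => by ring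
    rw [this, hr2, hs2]
    ring
  have hcs_le : ∑ j, α' j * α j ≤ r * s := by
    have := Real.sum_mul_le_sqrt_mul_sqrt Finset.univ α' α
    rwa [hnorm, ← hs, mul_comm s r] at this
  have hgap : Qobj b A lam α' - Qobj b A lam α
      = 1 / 2 * ∑ i, (A.mulVec α' i - A.mulVec α i) ^ 2
        + lam / r * (r * s - ∑ j, α' j * α j) := by
    unfold Qobj
    rw [hnorm, ← hs, hloss, kα, kα']
    field_simp
    ring
  have hA : 0 ≤ ∑ i, (A.mulVec α' i - A.mulVec α i) ^ 2 :=
    Finset.sum_nonneg fun i _ => sq_nonneg _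
  have hc : 0 < lam / r := div_pos hlam hr
  have hB : 0 ≤ lam / r * (r * s - ∑ j, α' j * α j) :=
    mul_nonneg hc.le (sub_nonneg.2 hcs_le)
  by_contra hlt
  have hA0 : ∑ i, (A.mulVec α' i - A.mulVec α i) ^ 2 = 0 := by linarith
  have hB0 : r * s - ∑ j, α' j * α j = 0 :=
    (mul_eq_zero.1 (by linarith : lam / r * (r * s - ∑ j, α' j * α j) = 0)).resolve_left hc.ne'
  have hfit : ∀ i, A.mulVec α' i = A.mulVec α i := fun i =>
    sub_eq_zero.1 (pow_eq_zero_iff two_ne_zero |>.1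
      ((Finset.sum_eq_zero_iff_of_nonneg fun i _ => sq_nonneg _).1 hA0 i (Finset.mem_univ i)))
  rw [hB0, mul_zero] at hcs
  have hpar : ∀ j, r * α' j = s * α j := fun j =>
    sub_eq_zero.1 (pow_eq_zero_iff two_ne_zero |>.1
      ((Finset.sum_eq_zero_iff_of_nonneg fun j _ => sq_nonneg _).1 hcs j (Finset.mem_univ j)))
  have hrs : r ≠ s := by
    rintro rfl
    exact hne (funext fun j => mul_left_cancel₀ hr.ne' (hpar j))
  have hfit0 : ∀ i, A.mulVec α i = 0 := fun i => by
    have h : r • A.mulVec α' = s • A.mulVec α := by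
      rw [← Matrix.mulVec_smul, ← Matrix.mulVec_smul]
      exact congrArg A.mulVec (funext hpar)
    have h' : r * A.mulVec α' i = s * A.mulVec α i := congrFun h i
    rw [hfit i] at h'
    by_contra h0
    exact hrs (mul_right_cancel₀ h0 h')
  simp only [hfit0, zero_mul, Finset.sum_const_zero] at kα
  exact (mul_pos hc (pow_pos hr 2)).ne kα
end

section
/- Convergence of cyclic exact block-wise minimization for the group lasso: let (β^(t))_{t≥0} be a sequence in ℝᵖ such that for every t there exist intermediate vectors γ⁰ = β^(t), γ¹, …, γ^K = β^(t+1) in ℝᵖ where, for each k = 1,…,K, γ^k agrees with γ^{k−1} on all blocks l ≠ k and the block (γ^k)_k minimizes α ↦ (1/2)‖(y − Σ_{l≠k} X_l (γ^{k−1})_l) − X_k α‖₂² + λ‖α‖₂ over α ∈ ℝ^{p_k}. Then L(β^(t)) converges to min_{β ∈ ℝᵖ} L(β) as t → ∞. -/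
/-- The partial residual `R_k = y − Σ_{l ≠ k} X_l β_l`. -/
noncomputable def partialResid {n K : ℕ} {p : Fin K → ℕ}
    (X : ∀ k, Matrix (Fin n) (Fin (p k)) ℝ) (y : Fin n → ℝ)
    (β : ∀ k, Fin (p k) → ℝ) (k : Fin K) (i : Fin n) : ℝ :=
  y i - ∑ l ∈ Finset.univ.erase k, ∑ j, X l i j * β l j

/-- The single-group subproblem objective
`α ↦ (1/2)‖R_k − X_k α‖₂² + λ‖α‖₂`. -/
noncomputable def subObj {n m : ℕ} (R : Fin n → ℝ)
    (Xk : Matrix (Fin n) (Fin m) ℝ) (lam : ℝ) (α : Fin m → ℝ) : ℝ :=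
  (1 / 2) * ∑ i, (R i - ∑ j, Xk i j * α j) ^ 2 + lam * Real.sqrt (∑ j, α j ^ 2)


open scoped InnerProductSpace

section BlockMinimizer

variable {H E : Type*} [NormedAddCommGroup H] [InnerProductSpace ℝ H]
  [SeminormedAddCommGroup E] [NormedSpace ℝ E]

/-- First-order optimality condition for a minimizer of `α ↦ ‖R - A α‖² / 2 + lam ‖α‖`. -/
theorem inner_residual_le_of_isMinimizer (A : E →L[ℝ] H) (R : H) {lam : ℝ} (hlam : 0 ≤ lam) (a : E)
    (h : ∀ α, (1 / 2) * ‖R - A a‖ ^ 2 + lam * ‖a‖ ≤ (1 / 2) * ‖R - A α‖ ^ 2 + lam * ‖α‖) (α : E) :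
    ⟪R - A a, A (α - a)⟫_ℝ ≤ lam * ‖α‖ - lam * ‖a‖ := by
  have key : ∀ s : ℝ, s ∈ Set.Ioo (0 : ℝ) 1 →
      ⟪R - A a, A (α - a)⟫_ℝ ≤ s * (‖A (α - a)‖ ^ 2 / 2) + (lam * ‖α‖ - lam * ‖a‖) := by
    rintro s ⟨h0, h1⟩
    have hs := h (a + s • (α - a))
    have e1 : R - A (a + s • (α - a)) = (R - A a) - s • A (α - a) := by
      simp only [map_add, map_smul]; abel
    have e2 : ‖a + s • (α - a)‖ ≤ (1 - s) * ‖a‖ + s * ‖α‖ := by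
      have : a + s • (α - a) = (1 - s) • a + s • α := by module
      rw [this]
      refine (norm_add_le _ _).trans_eq ?_
      rw [norm_smul, norm_smul, Real.norm_of_nonneg h0.le, Real.norm_of_nonneg (by linarith)]
    rw [e1, norm_sub_sq_real (R - A a), inner_smul_right, norm_smul, mul_pow, Real.norm_of_nonneg h0.le] at hs
    have e3 := mul_le_mul_of_nonneg_left e2 hlam
    refine le_of_mul_le_mul_left ?_ h0
    nlinarith
  have hlim : Filter.Tendsto
      (fun s : ℝ => s * (‖A (α - a)‖ ^ 2 / 2) + (lam * ‖α‖ - lam * ‖a‖))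
      (nhdsWithin 0 (Set.Ioi 0)) (nhds (lam * ‖α‖ - lam * ‖a‖)) := by
    have : Continuous fun s : ℝ => s * (‖A (α - a)‖ ^ 2 / 2) + (lam * ‖α‖ - lam * ‖a‖) := by
      fun_prop
    simpa using (this.tendsto 0).mono_left nhdsWithin_le_nhds
  refine ge_of_tendsto hlim ?_
  filter_upwards [Ioo_mem_nhdsGT (zero_lt_one' ℝ)] with s hs using key s hs

/-- A block minimizer decreases the objective by at least half the squared change of the fit. -/
theorem add_half_sq_le_of_isMinimizer (A : E →L[ℝ] H) (R : H) {lam : ℝ} (hlam : 0 ≤ lam) (a : E)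
    (h : ∀ α, (1 / 2) * ‖R - A a‖ ^ 2 + lam * ‖a‖ ≤ (1 / 2) * ‖R - A α‖ ^ 2 + lam * ‖α‖) (α : E) :
    (1 / 2) * ‖R - A a‖ ^ 2 + lam * ‖a‖ + (1 / 2) * ‖A (α - a)‖ ^ 2 ≤
      (1 / 2) * ‖R - A α‖ ^ 2 + lam * ‖α‖ := by
  have e1 : R - A α = (R - A a) - A (α - a) := by simp only [map_sub]; abel
  have := inner_residual_le_of_isMinimizer A R hlam a h α
  rw [e1, norm_sub_sq_real (R - A a)]
  linarith

end BlockMinimizer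

section Cycle

variable {H : Type*} [NormedAddCommGroup H] [InnerProductSpace ℝ H] {K : ℕ} {E : Fin K → Type*}
  [∀ k, SeminormedAddCommGroup (E k)] [∀ k, NormedSpace ℝ (E k)]

/-- The objective `‖y - Σ A_k b_k‖² / 2 + lam Σ ‖b_k‖`. -/
noncomputable def blockObj (A : ∀ k, E k →L[ℝ] H) (y : H) (lam : ℝ) (b : ∀ k, E k) : ℝ :=
  (1 / 2) * ‖y - ∑ k, A k (b k)‖ ^ 2 + lam * ∑ k, ‖b k‖

/-- `γ 0, …, γ K` is one cycle of exact blockwise minimization. -/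
def IsBlockCycle (A : ∀ k, E k →L[ℝ] H) (y : H) (lam : ℝ) (γ : ℕ → ∀ k, E k) : Prop :=
  ∀ k : Fin K, (∀ l, l ≠ k → γ (k.val + 1) l = γ k.val l) ∧
    ∀ α : E k,
      (1 / 2) * ‖(y - ∑ l ∈ Finset.univ.erase k, A l (γ k.val l)) - A k (γ (k.val + 1) k)‖ ^ 2 +
          lam * ‖γ (k.val + 1) k‖ ≤
        (1 / 2) * ‖(y - ∑ l ∈ Finset.univ.erase k, A l (γ k.val l)) - A k α‖ ^ 2 + lam * ‖α‖

theorem blockObj_nonneg (A : ∀ k, E k →L[ℝ] H) (y : H) {lam : ℝ} (hlam : 0 ≤ lam) (b : ∀ k, E k) :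
    0 ≤ blockObj A y lam b := by
  unfold blockObj
  positivity

theorem mul_norm_le_blockObj (A : ∀ k, E k →L[ℝ] H) (y : H) {lam : ℝ} (hlam : 0 ≤ lam)
    (b : ∀ k, E k) (k : Fin K) : lam * ‖b k‖ ≤ blockObj A y lam b := by
  have h1 : ‖b k‖ ≤ ∑ k, ‖b k‖ :=
    Finset.single_le_sum (f := fun k => ‖b k‖) (fun _ _ => norm_nonneg _) (Finset.mem_univ k)
  have h2 := mul_le_mul_of_nonneg_left h1 hlam
  have h3 : 0 ≤ (1 / 2) * ‖y - ∑ k, A k (b k)‖ ^ 2 := by positivity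
  unfold blockObj
  linarith

variable {A : ∀ k, E k →L[ℝ] H} {y : H} {lam : ℝ} {γ : ℕ → ∀ k, E k}

/-- The residual after updating block `k`. -/
theorem IsBlockCycle.residual_eq (h : IsBlockCycle A y lam γ) (k : Fin K) :
    (y - ∑ l ∈ Finset.univ.erase k, A l (γ k.val l)) - A k (γ (k.val + 1) k) =
      y - ∑ l, A l (γ (k.val + 1) l) := by
  rw [← Finset.sum_erase_add _ _ (Finset.mem_univ k), sub_sub]
  congr 2
  exact Finset.sum_congr rfl fun l hl => by rw [(h k).1 l (Finset.ne_of_mem_erase hl)]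

theorem IsBlockCycle.descent (hlam : 0 ≤ lam) (h : IsBlockCycle A y lam γ) (k : Fin K) :
    blockObj A y lam (γ (k.val + 1)) +
        (1 / 2) * ‖∑ l, A l (γ k.val l) - ∑ l, A l (γ (k.val + 1) l)‖ ^ 2 ≤
      blockObj A y lam (γ k.val) := by
  have h1 := add_half_sq_le_of_isMinimizer (A k) _ hlam _ (h k).2 (γ k.val k)
  have e1 : (y - ∑ l ∈ Finset.univ.erase k, A l (γ k.val l)) - A k (γ k.val k) =
      y - ∑ l, A l (γ k.val l) := by
    rw [← Finset.sum_erase_add _ _ (Finset.mem_univ k), sub_sub]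
  have e2 : ∑ l, A l (γ k.val l) - ∑ l, A l (γ (k.val + 1) l) =
      A k (γ k.val k - γ (k.val + 1) k) := by
    rw [map_sub, ← sub_sub_sub_cancel_left _ _ y, ← e1, ← h.residual_eq k]
    abel
  have e3 : ∑ l ∈ Finset.univ.erase k, ‖γ (k.val + 1) l‖ =
      ∑ l ∈ Finset.univ.erase k, ‖γ k.val l‖ :=
    Finset.sum_congr rfl fun l hl => by rw [(h k).1 l (Finset.ne_of_mem_erase hl)]
  rw [h.residual_eq k, e1] at h1
  unfold blockObj
  rw [e2, ← Finset.sum_erase_add _ (fun l => ‖γ (k.val + 1) l‖) (Finset.mem_univ k),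
    ← Finset.sum_erase_add _ (fun l => ‖γ k.val l‖) (Finset.mem_univ k), e3]
  linarith

theorem IsBlockCycle.blockObj_anti (hlam : 0 ≤ lam) (h : IsBlockCycle A y lam γ) {i j : ℕ}
    (hij : i ≤ j) (hj : j ≤ K) : blockObj A y lam (γ j) ≤ blockObj A y lam (γ i) := by
  induction j, hij using Nat.le_induction with
  | base => exact le_rfl
  | succ j hij ih =>
    have := h.descent hlam ⟨j, hj⟩
    have := ih (by lia)
    have h3 : 0 ≤ (1 / 2) * ‖∑ l, A l (γ j l) - ∑ l, A l (γ (j + 1) l)‖ ^ 2 := by positivity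
    linarith

theorem IsBlockCycle.norm_fit_step_le (hlam : 0 ≤ lam) (h : IsBlockCycle A y lam γ) {j : ℕ}
    (hj : j < K) :
    ‖∑ l, A l (γ j l) - ∑ l, A l (γ (j + 1) l)‖ ≤
      √(2 * (blockObj A y lam (γ 0) - blockObj A y lam (γ K))) := by
  apply Real.le_sqrt_of_sq_le
  have h1 := h.descent hlam ⟨j, hj⟩
  have h2 := h.blockObj_anti hlam (Nat.zero_le j) hj.le
  have h3 := h.blockObj_anti hlam hj le_rfl
  simp only at h1
  linarith

theorem IsBlockCycle.norm_fit_sub_le (hlam : 0 ≤ lam) (h : IsBlockCycle A y lam γ) {j : ℕ}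
    (hj : j ≤ K) :
    ‖∑ l, A l (γ j l) - ∑ l, A l (γ K l)‖ ≤
      K * √(2 * (blockObj A y lam (γ 0) - blockObj A y lam (γ K))) := by
  rw [← dist_eq_norm]
  refine (dist_le_Ico_sum_of_dist_le (f := fun i => ∑ l, A l (γ i l)) hj
    (d := fun _ => √(2 * (blockObj A y lam (γ 0) - blockObj A y lam (γ K)))) ?_).trans ?_
  · intro i _ hi
    rw [dist_eq_norm]
    exact h.norm_fit_step_le hlam hi
  · rw [Finset.sum_const, nsmul_eq_mul, Nat.card_Ico]
    gcongr
    lia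

theorem IsBlockCycle.block_eq (h : IsBlockCycle A y lam γ) (k : Fin K) {j : ℕ}
    (hkj : k.val + 1 ≤ j) (hj : j ≤ K) : γ j k = γ (k.val + 1) k := by
  induction j, hkj using Nat.le_induction with
  | base => rfl
  | succ j hkj ih =>
    rw [← ih (by lia)]
    exact (h ⟨j, hj⟩).1 k (by rw [Ne, Fin.ext_iff]; simp only; lia)

/-- The suboptimality after a cycle is controlled by the decrease achieved during that cycle. -/
theorem IsBlockCycle.blockObj_le (hlam : 0 ≤ lam) (h : IsBlockCycle A y lam γ) (b : ∀ k, E k) :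
    blockObj A y lam (γ K) ≤ blockObj A y lam b +
      K * √(2 * (blockObj A y lam (γ 0) - blockObj A y lam (γ K))) *
        ∑ k, ‖A k (b k - γ K k)‖ := by
  have hk : ∀ k : Fin K, ⟪y - ∑ l, A l (γ K l), A k (b k - γ K k)⟫_ℝ ≤
      (lam * ‖b k‖ - lam * ‖γ K k‖) +
        K * √(2 * (blockObj A y lam (γ 0) - blockObj A y lam (γ K))) * ‖A k (b k - γ K k)‖ := by
    intro k
    have h1 := inner_residual_le_of_isMinimizer (A k) _ hlam _ (h k).2 (b k)
    rw [h.residual_eq k, ← h.block_eq k k.isLt le_rfl] at h1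
    have h2 : ⟪∑ l, A l (γ (k.val + 1) l) - ∑ l, A l (γ K l), A k (b k - γ K k)⟫_ℝ ≤
        K * √(2 * (blockObj A y lam (γ 0) - blockObj A y lam (γ K))) * ‖A k (b k - γ K k)‖ :=
      (real_inner_le_norm _ _).trans
        (mul_le_mul_of_nonneg_right (h.norm_fit_sub_le hlam k.isLt) (norm_nonneg _))
    have e : y - ∑ l, A l (γ K l) = (y - ∑ l, A l (γ (k.val + 1) l)) +
        (∑ l, A l (γ (k.val + 1) l) - ∑ l, A l (γ K l)) := by abel
    rw [e, inner_add_left]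
    linarith
  have hsum := Finset.sum_le_sum fun k (_ : k ∈ Finset.univ) => hk k
  rw [← inner_sum, Finset.sum_add_distrib, Finset.sum_sub_distrib, ← Finset.mul_sum,
    ← Finset.mul_sum, ← Finset.mul_sum] at hsum
  have e : y - ∑ k, A k (b k) = (y - ∑ k, A k (γ K k)) - ∑ k, A k (b k - γ K k) := by
    simp only [map_sub, Finset.sum_sub_distrib]
    abel
  have hb : blockObj A y lam b = (1 / 2) * ‖y - ∑ k, A k (b k)‖ ^ 2 + lam * ∑ k, ‖b k‖ := rfl
  have hγ : blockObj A y lam (γ K) =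
    (1 / 2) * ‖y - ∑ k, A k (γ K k)‖ ^ 2 + lam * ∑ k, ‖γ K k‖ := rfl
  rw [e, norm_sub_sq_real] at hb
  have := sq_nonneg ‖∑ k, A k (b k - γ K k)‖
  linarith

/-- Cyclic exact blockwise minimization converges in objective value. -/
theorem tendsto_blockObj_iInf (hlam : 0 < lam) (β : ℕ → ∀ k, E k)
    (hβ : ∀ t, ∃ γ, γ 0 = β t ∧ γ K = β (t + 1) ∧ IsBlockCycle A y lam γ) :
    Filter.Tendsto (fun t => blockObj A y lam (β t)) Filter.atTop
      (nhds (⨅ b, blockObj A y lam b)) := by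
  have hanti : Antitone fun t => blockObj A y lam (β t) := by
    refine antitone_nat_of_succ_le fun t => ?_
    obtain ⟨γ, h0, hK, h⟩ := hβ t
    rw [← h0, ← hK]
    exact h.blockObj_anti hlam.le (Nat.zero_le K) le_rfl
  have hbdd : BddBelow (Set.range fun b => blockObj A y lam b) :=
    ⟨0, by rintro _ ⟨b, rfl⟩; exact blockObj_nonneg A y hlam.le b⟩
  have hbdd' : BddBelow (Set.range fun t => blockObj A y lam (β t)) :=
    ⟨0, by rintro _ ⟨t, rfl⟩; exact blockObj_nonneg A y hlam.le _⟩
  have hconv := tendsto_atTop_ciInf hanti hbdd'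
  set m := ⨅ t, blockObj A y lam (β t)
  have hconv' := hconv.comp (Filter.tendsto_add_atTop_nat 1)
  suffices hm : m = ⨅ b, blockObj A y lam b by rwa [hm] at hconv
  refine le_antisymm (le_ciInf fun b => ?_) (le_ciInf fun t => ciInf_le hbdd _)
  set C : ℝ := ∑ k, ‖A k‖ * (‖b k‖ + blockObj A y lam (β 0) / lam)
  have hstep : ∀ t, blockObj A y lam (β (t + 1)) ≤ blockObj A y lam b +
      K * √(2 * (blockObj A y lam (β t) - blockObj A y lam (β (t + 1)))) * C := by
    intro t
    obtain ⟨γ, h0, hK, h⟩ := hβ t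
    have h1 := h.blockObj_le hlam.le b
    rw [h0, hK] at h1
    refine h1.trans ?_
    gcongr
    refine Finset.sum_le_sum fun k _ => ?_
    refine ((A k).le_opNorm _).trans ?_
    gcongr
    refine (norm_sub_le _ _).trans ?_
    gcongr
    rw [le_div_iff₀' hlam]
    exact (mul_norm_le_blockObj A y hlam.le _ k).trans (hanti (Nat.zero_le _))
  have hlim : Filter.Tendsto (fun t => blockObj A y lam b +
      K * √(2 * (blockObj A y lam (β t) - blockObj A y lam (β (t + 1)))) * C) Filter.atTop
      (nhds (blockObj A y lam b)) := by
    have := ((((hconv.sub hconv').const_mul 2).sqrt.const_mul (K : ℝ)).mul_const C).const_add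
      (blockObj A y lam b)
    simpa using this
  exact le_of_tendsto_of_tendsto' hconv' hlim hstep

end Cycle

section GroupLasso

variable {n K : ℕ} {p : Fin K → ℕ}

/-- A matrix as a continuous linear map between Euclidean spaces. -/
noncomputable def designCLM {m : ℕ} (M : Matrix (Fin n) (Fin m) ℝ) :
    EuclideanSpace ℝ (Fin m) →L[ℝ] EuclideanSpace ℝ (Fin n) :=
  (Matrix.toLpLin 2 2 M).toContinuousLinearMap

theorem designCLM_apply {m : ℕ} (M : Matrix (Fin n) (Fin m) ℝ) (α : EuclideanSpace ℝ (Fin m))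
    (i : Fin n) : designCLM M α i = ∑ j, M i j * α j := by
  simp [designCLM, Matrix.toLpLin_apply, Matrix.mulVec, dotProduct]

theorem subObj_eq {m : ℕ} (R : Fin n → ℝ) (M : Matrix (Fin n) (Fin m) ℝ) (lam : ℝ)
    (α : Fin m → ℝ) :
    subObj R M lam α = (1 / 2) * ‖WithLp.toLp 2 R - designCLM M (WithLp.toLp 2 α)‖ ^ 2 +
      lam * ‖WithLp.toLp 2 α‖ := by
  rw [subObj, EuclideanSpace.norm_sq_eq]
  simp [EuclideanSpace.norm_eq, designCLM_apply]

theorem groupLasso_eq_blockObj (X : ∀ k, Matrix (Fin n) (Fin (p k)) ℝ) (y : Fin n → ℝ) (lam : ℝ)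
    (β : ∀ k, Fin (p k) → ℝ) :
    groupLasso X y lam β =
      blockObj (fun k => designCLM (X k)) (WithLp.toLp 2 y) lam fun k => WithLp.toLp 2 (β k) := by
  rw [groupLasso, blockObj, EuclideanSpace.norm_sq_eq]
  simp [fitted, groupNormSum, EuclideanSpace.norm_eq, designCLM_apply]

theorem toLp_partialResid (X : ∀ k, Matrix (Fin n) (Fin (p k)) ℝ) (y : Fin n → ℝ)
    (β : ∀ k, Fin (p k) → ℝ) (k : Fin K) :
    WithLp.toLp 2 (partialResid X y β k) =
      WithLp.toLp 2 y - ∑ l ∈ Finset.univ.erase k, designCLM (X l) (WithLp.toLp 2 (β l)) := by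
  ext i
  simp [partialResid, designCLM_apply]

end GroupLasso

/-- Convergence of cyclic exact block-wise minimization for the group lasso:
the objective values of the iterates converge to the minimum of the objective
(which is always attained, so the minimum equals the infimum). -/
theorem group_lasso_blockwise_descent_converges
    {n K : ℕ} {p : Fin K → ℕ}
    (X : ∀ k, Matrix (Fin n) (Fin (p k)) ℝ) (y : Fin n → ℝ)
    (lam : ℝ) (hlam : 0 < lam)
    (β : ℕ → ∀ k, Fin (p k) → ℝ)
    (hstep : ∀ t : ℕ, ∃ γ : ℕ → ∀ k, Fin (p k) → ℝ,
      γ 0 = β t ∧ γ K = β (t + 1) ∧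
      ∀ k : Fin K,
        (∀ l, l ≠ k → γ (k.val + 1) l = γ k.val l) ∧
        (∀ α : Fin (p k) → ℝ,
          subObj (partialResid X y (γ k.val) k) (X k) lam (γ (k.val + 1) k)
            ≤ subObj (partialResid X y (γ k.val) k) (X k) lam α)) :
    Filter.Tendsto (fun t => groupLasso X y lam (β t)) Filter.atTop
      (nhds (⨅ β' : ∀ k, Fin (p k) → ℝ, groupLasso X y lam β')) := by
  have hmain := tendsto_blockObj_iInf (A := fun k => designCLM (X k)) (y := WithLp.toLp 2 y) hlam
    (fun t k => WithLp.toLp 2 (β t k)) fun t => by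
      obtain ⟨γ, h0, hK, h⟩ := hstep t
      refine ⟨fun j k => WithLp.toLp 2 (γ j k), by simp only [h0], by simp only [hK], fun k => ?_⟩
      refine ⟨fun l hl => by simp only [(h k).1 l hl], fun α => ?_⟩
      have := (h k).2 α.ofLp
      rwa [subObj_eq, subObj_eq, toLp_partialResid] at this
  have hinf : ⨅ β', groupLasso X y lam β' =
      ⨅ b, blockObj (fun k => designCLM (X k)) (WithLp.toLp 2 y) lam b :=
    Function.Surjective.iInf_congr (fun β' k => WithLp.toLp 2 (β' k))
      (fun b => ⟨fun k => (b k).ofLp, rfl⟩) fun β' => (groupLasso_eq_blockObj X y lam β').symm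
  rw [hinf]
  simpa only [groupLasso_eq_blockObj] using hmain
end

section
/- Accuracy bound for the group lasso: let β* ∈ ℝᵖ and let w* ∈ ℝᵖ satisfy the penalty-subgradient condition that for all γ ∈ ℝᵖ, λ Σ_{k=1}^K ‖γ_k‖₂ ≥ λ Σ_{k=1}^K ‖β*_k‖₂ + ⟨w* + Xᵀ(y − Xβ*), γ − β*⟩. Let β̂ be any minimizer of L and let ŷ = Xβ̂ be the optimal fitted values. Then ‖Xβ* − ŷ‖₂² ≤ 2⟨w*, β*⟩ + 2‖w*‖₂‖β̂‖₂. -/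
/-- The Euclidean inner product on blockwise-partitioned `ℝᵖ`. -/
noncomputable def blockInner {K : ℕ} {p : Fin K → ℕ}
    (w δ : ∀ k, Fin (p k) → ℝ) : ℝ :=
  ∑ k, ∑ j, w k j * δ k j

/-- The full Euclidean norm `‖β‖₂` of a blockwise-partitioned vector. -/
noncomputable def blockNorm {K : ℕ} {p : Fin K → ℕ}
    (β : ∀ k, Fin (p k) → ℝ) : ℝ :=
  Real.sqrt (∑ k, ∑ j, β k j ^ 2)

theorem neg_blockInner_le_blockNorm_mul_blockNorm {K : ℕ} {p : Fin K → ℕ}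
    (w δ : ∀ k, Fin (p k) → ℝ) :
    -blockInner w δ ≤ blockNorm w * blockNorm δ := by
  have h := Real.sum_mul_le_sqrt_mul_sqrt Finset.univ
    (fun x : (k : Fin K) × Fin (p k) => -w x.1 x.2) (fun x => δ x.1 x.2)
  simpa [blockInner, blockNorm, Fintype.sum_sigma] using h

/-- `⟨w + Xᵀr, γ − β⟩ = ⟨w, γ⟩ − ⟨w, β⟩ + ⟨r, Xγ − Xβ⟩`. -/
theorem sum_add_transpose_mul_sub {n K : ℕ} {p : Fin K → ℕ}
    (X : ∀ k, Matrix (Fin n) (Fin (p k)) ℝ) (r : Fin n → ℝ)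
    (w γ β : ∀ k, Fin (p k) → ℝ) :
    ∑ k, ∑ j, (w k j + ∑ i, X k i j * r i) * (γ k j - β k j)
      = blockInner w γ - blockInner w β
        + ∑ i, r i * (fitted X γ i - fitted X β i) := by
  have h : ∑ i, r i * (fitted X γ i - fitted X β i)
      = ∑ k, ∑ j, (∑ i, X k i j * r i) * (γ k j - β k j) := by
    simp only [fitted, ← Finset.sum_sub_distrib, Finset.mul_sum, Finset.sum_mul]
    rw [Finset.sum_comm]
    refine Finset.sum_congr rfl fun k _ => ?_
    rw [Finset.sum_comm]
    refine Finset.sum_congr rfl fun j _ => Finset.sum_congr rfl fun i _ => ?_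
    ring
  rw [h]
  simp only [blockInner, ← Finset.sum_sub_distrib, ← Finset.sum_add_distrib]
  refine Finset.sum_congr rfl fun k _ => Finset.sum_congr rfl fun j _ => ?_
  ring

/-- Accuracy bound for the group lasso: for any `β*` with penalty-subgradient
`w*` and any minimizer `β̂` of `L` (with fitted values `ŷ = Xβ̂`),
`‖Xβ* − ŷ‖₂² ≤ 2⟨w*, β*⟩ + 2‖w*‖₂‖β̂‖₂`. -/
theorem group_lasso_accuracy_bound
    {n K : ℕ} {p : Fin K → ℕ}
    (X : ∀ k, Matrix (Fin n) (Fin (p k)) ℝ) (y : Fin n → ℝ)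
    (lam : ℝ) (hlam : 0 < lam)
    (βstar wstar βhat : ∀ k, Fin (p k) → ℝ)
    (hsub : ∀ γ : ∀ k, Fin (p k) → ℝ,
      lam * groupNormSum γ ≥ lam * groupNormSum βstar
        + ∑ k, ∑ j, (wstar k j + ∑ i, X k i j * (y i - fitted X βstar i))
            * (γ k j - βstar k j))
    (hmin : ∀ β, groupLasso X y lam βhat ≤ groupLasso X y lam β) :
    ∑ i, (fitted X βstar i - fitted X βhat i) ^ 2
      ≤ 2 * blockInner wstar βstar + 2 * blockNorm wstar * blockNorm βhat := by
  have hL := hmin βstar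
  have hS := hsub βhat
  rw [sum_add_transpose_mul_sub X (fun i => y i - fitted X βstar i)] at hS
  have hCS := neg_blockInner_le_blockNorm_mul_blockNorm wstar βhat
  have hexpand : ∑ i, (y i - fitted X βhat i) ^ 2
      = ∑ i, (y i - fitted X βstar i) ^ 2
        + ∑ i, (fitted X βstar i - fitted X βhat i) ^ 2
        - 2 * ∑ i, (y i - fitted X βstar i) * (fitted X βhat i - fitted X βstar i) := by
    rw [Finset.mul_sum, ← Finset.sum_add_distrib, ← Finset.sum_sub_distrib]
    refine Finset.sum_congr rfl fun i _ => ?_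
    ring
  unfold groupLasso at hL
  linarith
end

section
/- Zero is a minimizer of the sparse-group-lasso single-group objective Q₁ if and only if ‖{Aᵀb}_{λ₂}‖₂ ≤ λ₁; that is, α = 0 satisfies Q₁(0) ≤ Q₁(α) for all α ∈ ℝ^q if and only if the Euclidean norm of the elementwise soft-thresholding of Aᵀb at level λ₂ is at most λ₁. -/
/-- Elementwise soft-thresholding at level `c`: `{x}_c = sign(x)·max(|x| − c, 0)`. -/
noncomputable def softThresh (c x : ℝ) : ℝ := Real.sign x * max (|x| - c) 0

/-- The single-group sparse group lasso objective
`Q₁(α) = (1/2)‖b − Aα‖₂² + λ₁‖α‖₂ + λ₂‖α‖₁`. -/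
noncomputable def Q1obj {n q : ℕ} (b : Fin n → ℝ) (A : Matrix (Fin n) (Fin q) ℝ)
    (lam1 lam2 : ℝ) (α : Fin q → ℝ) : ℝ :=
  (1 / 2) * ∑ i, (b i - A.mulVec α i) ^ 2 + lam1 * Real.sqrt (∑ j, α j ^ 2)
    + lam2 * ∑ j, |α j|

theorem mul_le_softThresh_mul_add {c : ℝ} (hc : 0 < c) (x y : ℝ) :
    x * y ≤ softThresh c x * y + c * |y| := by
  have h₁ := le_abs_self y
  have h₂ := neg_le_abs y
  unfold softThresh
  rcases lt_trichotomy x 0 with hx | rfl | hx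
  · rw [Real.sign_of_neg hx, abs_of_neg hx]
    rcases max_cases (-x - c) 0 with ⟨h, h'⟩ | ⟨h, h'⟩ <;> rw [h] <;> nlinarith
  · simp; positivity
  · rw [Real.sign_of_pos hx, abs_of_pos hx]
    rcases max_cases (x - c) 0 with ⟨h, h'⟩ | ⟨h, h'⟩ <;> rw [h] <;> nlinarith

theorem mul_softThresh (c x : ℝ) :
    x * softThresh c x = softThresh c x ^ 2 + c * |softThresh c x| := by
  unfold softThresh
  rcases lt_trichotomy x 0 with hx | rfl | hx
  · rw [Real.sign_of_neg hx, abs_of_neg hx, abs_mul, abs_of_nonneg (le_max_right (-x - c) 0)]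
    rcases max_cases (-x - c) 0 with ⟨h, h'⟩ | ⟨h, h'⟩ <;> rw [h] <;> ring
  · simp
  · rw [Real.sign_of_pos hx, abs_of_pos hx, abs_mul, abs_of_nonneg (le_max_right (x - c) 0)]
    rcases max_cases (x - c) 0 with ⟨h, h'⟩ | ⟨h, h'⟩ <;> rw [h] <;> ring

theorem Q1obj_eq_zero_add {n q : ℕ} (b : Fin n → ℝ) (A : Matrix (Fin n) (Fin q) ℝ)
    (lam1 lam2 : ℝ) (α : Fin q → ℝ) :
    Q1obj b A lam1 lam2 α = Q1obj b A lam1 lam2 0 + ((1 / 2) * ∑ i, A.mulVec α i ^ 2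
      - ∑ j, A.transpose.mulVec b j * α j + lam1 * Real.sqrt (∑ j, α j ^ 2)
      + lam2 * ∑ j, |α j|) := by
  have h : ∑ i, b i * A.mulVec α i = ∑ j, A.transpose.mulVec b j * α j := by
    have := Matrix.dotProduct_mulVec b A α
    rwa [← Matrix.mulVec_transpose] at this
  have h' : ∑ i, (b i - A.mulVec α i) ^ 2
      = ∑ i, b i ^ 2 - 2 * ∑ i, b i * A.mulVec α i + ∑ i, A.mulVec α i ^ 2 := by
    rw [Finset.mul_sum, ← Finset.sum_sub_distrib, ← Finset.sum_add_distrib]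
    exact Finset.sum_congr rfl fun i _ => by ring
  unfold Q1obj
  rw [h', h]
  simp
  ring

/-- `α = 0` minimizes `Q₁` if and only if `‖{Aᵀb}_{λ₂}‖₂ ≤ λ₁`. -/
theorem Q1obj_zero_minimizer_iff
    {n q : ℕ} (b : Fin n → ℝ) (A : Matrix (Fin n) (Fin q) ℝ)
    (lam1 lam2 : ℝ) (hlam1 : 0 < lam1) (hlam2 : 0 < lam2) :
    (∀ α, Q1obj b A lam1 lam2 0 ≤ Q1obj b A lam1 lam2 α) ↔
      Real.sqrt (∑ j, (softThresh lam2 (A.transpose.mulVec b j)) ^ 2) ≤ lam1 := by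
  set s : Fin q → ℝ := fun j => softThresh lam2 (A.transpose.mulVec b j)
  change _ ↔ Real.sqrt (∑ j, s j ^ 2) ≤ lam1
  have hS : 0 ≤ ∑ j, s j ^ 2 := Finset.sum_nonneg fun j _ => sq_nonneg _
  constructor
  · intro hmin
    by_contra! hlt
    set S := Real.sqrt (∑ j, s j ^ 2) with hSdef
    have hSsq : S ^ 2 = ∑ j, s j ^ 2 := Real.sq_sqrt hS
    have hcs : ∑ j, A.transpose.mulVec b j * s j = S ^ 2 + lam2 * ∑ j, |s j| := by
      rw [hSsq, Finset.mul_sum, ← Finset.sum_add_distrib]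
      exact Finset.sum_congr rfl fun j _ => mul_softThresh _ _
    set K := (1 / 2) * ∑ i, A.mulVec s i ^ 2 with hK
    have hK0 : 0 ≤ K := by positivity
    have hd : 0 < S ^ 2 - lam1 * S := by nlinarith
    have key : ∀ t : ℝ, 0 < t → S ^ 2 - lam1 * S ≤ t * K := by
      intro t ht
      have h := hmin (t • s)
      rw [Q1obj_eq_zero_add b A lam1 lam2 (t • s)] at h
      simp only [Matrix.mulVec_smul, Pi.smul_apply, smul_eq_mul, mul_pow, abs_mul,
        mul_left_comm _ t, ← Finset.mul_sum, Real.sqrt_mul (sq_nonneg t), Real.sqrt_sq ht.le,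
        abs_of_pos ht, hcs, ← hSdef] at h
      refine le_of_mul_le_mul_left ?_ ht
      rw [hK]
      linarith
    have h := key ((S ^ 2 - lam1 * S) / (K + 1)) (by positivity)
    rw [div_mul_eq_mul_div, le_div_iff₀ (by positivity)] at h
    linarith
  · intro hle α
    rw [Q1obj_eq_zero_add b A lam1 lam2 α]
    have h₁ : ∑ j, A.transpose.mulVec b j * α j ≤ ∑ j, s j * α j + lam2 * ∑ j, |α j| := by
      rw [Finset.mul_sum, ← Finset.sum_add_distrib]
      exact Finset.sum_le_sum fun j _ => mul_le_softThresh_mul_add hlam2 _ _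
    have h₂ := Real.sum_mul_le_sqrt_mul_sqrt Finset.univ s α
    have h₃ := mul_le_mul_of_nonneg_right hle (Real.sqrt_nonneg (∑ j, α j ^ 2))
    have h₄ : 0 ≤ ∑ i, A.mulVec α i ^ 2 := Finset.sum_nonneg fun i _ => sq_nonneg _
    linarith
end

section
/- Necessary stationarity equation on the support of the sparse-group-lasso minimizer: if α̂ ∈ ℝ^q is a nonzero minimizer of Q₁, then for every j with α̂_j ≠ 0, (AᵀAα̂)_j + λ₁ α̂_j/‖α̂‖₂ + λ₂ sign(α̂_j) = (Aᵀb)_j; moreover, for every j with α̂_j = 0, |{(Aᵀ(b − Aα̂))_j}_{λ₂}| ≤ λ₁. -/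
open Filter

/-- Change of `Q1obj` under a perturbation of a single coordinate. -/
theorem Q1obj_add_single {n q : ℕ} (b : Fin n → ℝ) (A : Matrix (Fin n) (Fin q) ℝ)
    (lam1 lam2 : ℝ) (α : Fin q → ℝ) (j : Fin q) (t : ℝ) :
    Q1obj b A lam1 lam2 (α + Pi.single j t) - Q1obj b A lam1 lam2 α =
      -(t * A.transpose.mulVec (b - A.mulVec α) j) + t ^ 2 * ((∑ i, A i j ^ 2) / 2)
        + lam1 * (Real.sqrt (∑ k, α k ^ 2 + 2 * t * α j + t ^ 2) - Real.sqrt (∑ k, α k ^ 2))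
        + lam2 * (|α j + t| - |α j|) := by
  have h_loss : ∑ i, (b i - A.mulVec (α + Pi.single j t) i) ^ 2 =
      ∑ i, (b i - A.mulVec α i) ^ 2 - 2 * t * A.transpose.mulVec (b - A.mulVec α) j
        + t ^ 2 * ∑ i, A i j ^ 2 := by
    have h_grad : A.transpose.mulVec (b - A.mulVec α) j
        = ∑ i, A i j * (b i - A.mulVec α i) := rfl
    rw [h_grad, Finset.mul_sum, Finset.mul_sum, ← Finset.sum_sub_distrib,
      ← Finset.sum_add_distrib]
    refine Finset.sum_congr rfl fun i _ => ?_
    rw [Matrix.mulVec_add, Pi.add_apply, Matrix.mulVec_single]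
    simp only [Pi.smul_apply, MulOpposite.smul_eq_mul_unop, MulOpposite.unop_op, Matrix.col_apply]
    ring
  have h_sum (f : ℝ → ℝ) : ∑ k, f ((α + Pi.single j t : Fin q → ℝ) k) =
      ∑ k, f (α k) + (f (α j + t) - f (α j)) := by
    rw [← sub_eq_iff_eq_add', ← Finset.sum_sub_distrib, Finset.sum_eq_single j]
    · simp
    · intro k _ hk
      simp [hk]
    · simp
  have h_sq : ∑ k, (α + Pi.single j t : Fin q → ℝ) k ^ 2 = ∑ k, α k ^ 2 + 2 * t * α j + t ^ 2 := by
    rw [h_sum fun x => x ^ 2]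
    ring
  unfold Q1obj
  rw [h_loss, h_sq, h_sum fun x => |x|]
  ring

/-- Soft-thresholding at level `c` shrinks absolute values by `c`. -/
theorem abs_softThresh_le (c x : ℝ) : |softThresh c x| ≤ max (|x| - c) 0 := by
  unfold softThresh
  rw [abs_mul, abs_of_nonneg (le_max_right (|x| - c) 0)]
  refine mul_le_of_le_one_left (le_max_right _ _) ?_
  rcases Real.sign_apply_eq x with h | h | h <;> simp [h]

/-- Necessary stationarity conditions for a nonzero minimizer of `Q₁`:
the subgradient equation holds on the support, and the soft-threshold bound
holds off the support. -/
theorem Q1obj_minimizer_stationarity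
    {n q : ℕ} (b : Fin n → ℝ) (A : Matrix (Fin n) (Fin q) ℝ)
    (lam1 lam2 : ℝ) (hlam1 : 0 < lam1) (hlam2 : 0 < lam2)
    (αhat : Fin q → ℝ) (hα : αhat ≠ 0)
    (hmin : ∀ α, Q1obj b A lam1 lam2 αhat ≤ Q1obj b A lam1 lam2 α) :
    (∀ j, αhat j ≠ 0 →
      (A.transpose * A).mulVec αhat j
        + lam1 * αhat j / Real.sqrt (∑ j', αhat j' ^ 2)
        + lam2 * Real.sign (αhat j) = A.transpose.mulVec b j) ∧
    (∀ j, αhat j = 0 →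
      |softThresh lam2 (A.transpose.mulVec (b - A.mulVec αhat) j)| ≤ lam1) := by
  have h_nonneg (j : Fin q) (t : ℝ) := sub_nonneg.2 (hmin (αhat + Pi.single j t))
  simp only [Q1obj_add_single] at h_nonneg
  have h_pos : 0 < ∑ k, αhat k ^ 2 := by
    obtain ⟨k, hk⟩ := Function.ne_iff.1 hα
    exact Finset.sum_pos' (fun i _ => sq_nonneg _) ⟨k, Finset.mem_univ k, sq_pos_of_ne_zero hk⟩
  refine ⟨fun j hj => ?_, fun j hj => ?_⟩
  · have h_sqrt : HasDerivAt
        (fun t : ℝ => Real.sqrt (∑ k, αhat k ^ 2 + 2 * t * αhat j + t ^ 2))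
        (αhat j / Real.sqrt (∑ k, αhat k ^ 2)) 0 := by
      have h_quad : HasDerivAt (fun t : ℝ => ∑ k, αhat k ^ 2 + 2 * t * αhat j + t ^ 2)
          (2 * αhat j) 0 := by
        exact (((((hasDerivAt_id (0 : ℝ)).const_mul 2).mul_const (αhat j)).const_add
          (∑ k, αhat k ^ 2)).add (hasDerivAt_pow 2 (0 : ℝ))).congr_deriv (by simp)
      convert h_quad.sqrt (by simpa using h_pos.ne') using 1
      simp only [mul_zero, zero_mul, add_zero, ne_eq, OfNat.ofNat_ne_zero, not_false_eq_true,
        zero_pow]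
      rw [mul_div_mul_left _ _ two_ne_zero]
    have h_abs : HasDerivAt (fun t : ℝ => |αhat j + t|) (Real.sign (αhat j)) 0 := by
      have h_shift : HasDerivAt (fun t : ℝ => αhat j + t) 1 0 :=
        (hasDerivAt_id (0 : ℝ)).const_add _
      rcases hj.lt_or_gt with h | h
      · rw [Real.sign_of_neg h]
        exact (HasDerivAt.comp (0 : ℝ) (hasDerivAt_abs_neg (by simpa using h)) h_shift).congr_deriv
          (by simp)
      · rw [Real.sign_of_pos h]
        exact (HasDerivAt.comp (0 : ℝ) (hasDerivAt_abs_pos (by simpa using h)) h_shift).congr_deriv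
          (by simp)
    have h_deriv := ((((hasDerivAt_id (0 : ℝ)).mul_const
      (A.transpose.mulVec (b - A.mulVec αhat) j)).neg.add
      ((hasDerivAt_pow 2 (0 : ℝ)).mul_const ((∑ i, A i j ^ 2) / 2))).add
      ((h_sqrt.sub_const (Real.sqrt (∑ k, αhat k ^ 2))).const_mul lam1)).add
      ((h_abs.sub_const |αhat j|).const_mul lam2)
    have h_zero := IsLocalMin.hasDerivAt_eq_zero
      (Eventually.of_forall fun t => by simpa using h_nonneg j t) h_deriv
    rw [Matrix.mulVec_sub, Matrix.mulVec_mulVec, Pi.sub_apply] at h_zero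
    norm_num at h_zero
    rw [mul_div_assoc]
    linarith
  · refine (abs_softThresh_le _ _).trans (max_le ?_ hlam1.le)
    set g := A.transpose.mulVec (b - A.mulVec αhat) j
    set c := (∑ i, A i j ^ 2) / 2
    have hc : 0 ≤ c := by positivity
    have h_bound (t : ℝ) : t * g ≤ t ^ 2 * c + (lam1 + lam2) * |t| := by
      have h_sqrt : Real.sqrt (∑ k, αhat k ^ 2 + t ^ 2) ≤
          Real.sqrt (∑ k, αhat k ^ 2) + |t| := by
        refine Real.sqrt_le_iff.2 ⟨by positivity, ?_⟩
        rw [add_sq, Real.sq_sqrt h_pos.le, sq_abs]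
        gcongr
        exact le_add_of_nonneg_right (by positivity)
      have h := h_nonneg j t
      simp only [hj, mul_zero, add_zero, zero_add, abs_zero, sub_zero] at h
      have h_mul := mul_le_mul_of_nonneg_left (sub_le_iff_le_add'.2 h_sqrt) hlam1.le
      simp only [g, c]
      linarith
    have h_abs (s : ℝ) (hs : 0 < s) : |g| ≤ s * c + (lam1 + lam2) := by
      refine abs_le'.2 ⟨?_, ?_⟩
      · have h := h_bound s
        rw [abs_of_pos hs] at h
        exact le_of_mul_le_mul_left (by linarith) hs
      · have h := h_bound (-s)
        rw [abs_neg, abs_of_pos hs] at h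
        exact le_of_mul_le_mul_left (by linarith) hs
    rw [sub_le_iff_le_add]
    refine le_of_forall_pos_le_add fun ε hε => ?_
    have h := h_abs (ε / (c + 1)) (by positivity)
    have h_small : ε / (c + 1) * c ≤ ε := by
      rw [div_mul_eq_mul_div, div_le_iff₀ (by positivity)]
      nlinarith
    linarith
end

section
/- The 'zero trap' for coordinate descent on the group lasso: define L(β) = (1/2)(1 − β₁)² + (1/2)(1 − β₂)² + ‖β‖₂ for β = (β₁, β₂) ∈ ℝ². Then (i) the function t ↦ L(t, 0) is minimized over t ∈ ℝ at t = 0, and the function t ↦ L(0, t) is minimized over t ∈ ℝ at t = 0, so coordinate descent started at (0,0) never moves; but (ii) the unique minimizer of L over ℝ² is β₁ = β₂ = 1 − √2/2, so (0,0) is not a minimizer of L. -/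
/-- The objective of the `zero trap' example: the group lasso objective with a
single group of two covariates, `y = (1,1)`, `X = I₂`, and `λ = 1`:
`L(β) = (1/2)(1 − β₁)² + (1/2)(1 − β₂)² + ‖β‖₂`. -/
noncomputable def zeroTrapObj (b1 b2 : ℝ) : ℝ :=
  (1 / 2) * (1 - b1) ^ 2 + (1 / 2) * (1 - b2) ^ 2 + Real.sqrt (b1 ^ 2 + b2 ^ 2)

theorem zeroTrapObj_zero_zero : zeroTrapObj 0 0 = 1 := by
  norm_num [zeroTrapObj]

theorem zeroTrapObj_comm (b1 b2 : ℝ) : zeroTrapObj b1 b2 = zeroTrapObj b2 b1 := by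
  unfold zeroTrapObj
  rw [add_comm (b1 ^ 2)]
  ring

theorem zeroTrapObj_zero_le (t : ℝ) : zeroTrapObj 0 0 ≤ zeroTrapObj t 0 := by
  have h : Real.sqrt (t ^ 2 + 0 ^ 2) = |t| := by
    rw [zero_pow two_ne_zero, add_zero, Real.sqrt_sq_eq_abs]
  rw [zeroTrapObj_zero_zero, zeroTrapObj, h]
  nlinarith [le_abs_self t, sq_nonneg t]

theorem zeroTrapObj_minimizer :
    zeroTrapObj (1 - Real.sqrt 2 / 2) (1 - Real.sqrt 2 / 2) = Real.sqrt 2 - 1 / 2 := by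
  have hs : Real.sqrt 2 ^ 2 = 2 := Real.sq_sqrt zero_le_two
  have h : Real.sqrt ((1 - Real.sqrt 2 / 2) ^ 2 + (1 - Real.sqrt 2 / 2) ^ 2)
      = Real.sqrt 2 - 1 := by
    rw [Real.sqrt_eq_iff_eq_sq (by positivity) (by linarith [Real.one_lt_sqrt_two])]
    linear_combination -(1 / 2) * hs
  rw [zeroTrapObj, h]
  linear_combination (1 / 4) * hs

/-- Quadratic growth of the objective around its minimizer. -/
theorem zeroTrapObj_quadratic_growth (b1 b2 : ℝ) :
    Real.sqrt 2 - 1 / 2 +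
      ((b1 - (1 - Real.sqrt 2 / 2)) ^ 2 + (b2 - (1 - Real.sqrt 2 / 2)) ^ 2) / 2
      ≤ zeroTrapObj b1 b2 := by
  have hs : Real.sqrt 2 ^ 2 = 2 := Real.sq_sqrt zero_le_two
  have h : Real.sqrt 2 / 2 * (b1 + b2) ≤ Real.sqrt (b1 ^ 2 + b2 ^ 2) := by
    apply Real.le_sqrt_of_sq_le
    rw [mul_pow, div_pow, hs]
    nlinarith [sq_nonneg (b1 - b2)]
  unfold zeroTrapObj
  nlinarith

/-- The `zero trap' for coordinate descent on the group lasso: each coordinate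
function is minimized at `0` (so coordinate descent started at `(0,0)` never
moves), yet the unique minimizer of `L` is `β₁ = β₂ = 1 − √2/2`; in particular
`(0,0)` is not a minimizer of `L`. -/
theorem zero_trap :
    (∀ t : ℝ, zeroTrapObj 0 0 ≤ zeroTrapObj t 0) ∧
    (∀ t : ℝ, zeroTrapObj 0 0 ≤ zeroTrapObj 0 t) ∧
    (∀ b1 b2 : ℝ, (b1, b2) ≠ (1 - Real.sqrt 2 / 2, 1 - Real.sqrt 2 / 2) →
      zeroTrapObj (1 - Real.sqrt 2 / 2) (1 - Real.sqrt 2 / 2) < zeroTrapObj b1 b2) ∧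
    ¬ (∀ b1 b2 : ℝ, zeroTrapObj 0 0 ≤ zeroTrapObj b1 b2) := by
  refine ⟨zeroTrapObj_zero_le, fun t => zeroTrapObj_comm 0 t ▸ zeroTrapObj_zero_le t, ?_, ?_⟩
  · intro b1 b2 hne
    rw [zeroTrapObj_minimizer]
    refine lt_of_lt_of_le (lt_add_of_pos_right _ ?_) (zeroTrapObj_quadratic_growth b1 b2)
    by_contra! h
    refine hne (Prod.ext ?_ ?_) <;> dsimp only <;>
      nlinarith [sq_nonneg (b1 - (1 - Real.sqrt 2 / 2)), sq_nonneg (b2 - (1 - Real.sqrt 2 / 2))]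
  · intro h
    have hle := h (1 - Real.sqrt 2 / 2) (1 - Real.sqrt 2 / 2)
    rw [zeroTrapObj_zero_zero, zeroTrapObj_minimizer] at hle
    nlinarith [Real.sq_sqrt (zero_le_two (α := ℝ)), Real.sqrt_nonneg 2]
end
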